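/- Let G be a finite simple graph with n vertices and maximum degree Δ ≥ 1. Sample each vertex independently with probability p = 1/√Δ into a set V_F. Then with probability at least 1 − 2^{−6n/√Δ} − n·2^{−6√Δ}, the induced subgraph G[V_F] contains at most 36n edges. -/

import Mathlib

open SimpleGraph MeasureTheory

/-- The Bernoulli measure on `Bool` with success probability `p`. -/
noncomputable def bernoulliMeasure (p : ℝ) : Measure Bool :=
  ENNReal.ofReal p • Measure.dirac true + ENNReal.ofReal (1 - p) • Measure.dirac false

/-- The number of edges of `G` both of whose endpoints are sampled (i.e. mapped to `true`
by `ω`). -/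
noncomputable def sampledEdgeCount {V : Type*} (G : SimpleGraph V) (ω : V → Bool) : ℕ :=
  {e | e ∈ G.edgeSet ∧ ∀ v ∈ e, ω v = true}.ncard

/-- With `p ∈ [0, 1]`, the Bernoulli measure is a probability measure. -/
lemma isProbabilityMeasure_bernoulliMeasure {p : ℝ} (h0 : 0 ≤ p) (h1 : p ≤ 1) :
    IsProbabilityMeasure (bernoulliMeasure p) := by
  constructor
  simp only [bernoulliMeasure, Measure.coe_add, Measure.coe_smul, Pi.add_apply, Pi.smul_apply,
    measure_univ, smul_eq_mul, mul_one]
  rw [← ENNReal.ofReal_add h0 (by linarith)]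
  simp

lemma integral_bernoulliMeasure {p : ℝ} (h0 : 0 ≤ p) (h1 : p ≤ 1) (f : Bool → ℝ) :
    ∫ b, f b ∂bernoulliMeasure p = p * f true + (1 - p) * f false := by
  have := (Measure.dirac true).smul_finite (ENNReal.ofReal_ne_top (r := p))
  have := (Measure.dirac false).smul_finite (ENNReal.ofReal_ne_top (r := 1 - p))
  rw [bernoulliMeasure, integral_add_measure Integrable.of_finite Integrable.of_finite,
    integral_smul_measure, integral_smul_measure, integral_dirac, integral_dirac,
    ENNReal.toReal_ofReal h0, ENNReal.toReal_ofReal (by linarith)]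
  simp

/-- Chernoff bound: the number of successes in a set `S` of independent Bernoulli trials with
`#S * p ≤ M` exceeds `6 * M` with probability at most `2 ^ (-6 * M)`. -/
lemma measureReal_six_mul_lt_card_filter_le {V : Type*} [Fintype V] {p : ℝ} (h0 : 0 ≤ p)
    (h1 : p ≤ 1) (S : Finset V) {M : ℝ} (hM : S.card * p ≤ M) :
    (Measure.pi fun _ : V => bernoulliMeasure p).real
      {ω | 6 * M < ((S.filter fun v => ω v = true).card : ℝ)} ≤ (2 : ℝ) ^ (-(6 * M)) := by
  classical
  have := isProbabilityMeasure_bernoulliMeasure h0 h1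
  set μ := Measure.pi fun _ : V => bernoulliMeasure p
  let f : V → Bool → ℝ := fun v b => if v ∈ S then (if b = true then 4 else 1) else 1
  have hf : ∀ ω : V → Bool,
      ∏ v, f v (ω v) = 4 ^ (S.filter fun v => ω v = true).card := by
    intro ω
    simp only [f]
    rw [Finset.prod_ite_mem, Finset.univ_inter, Finset.prod_ite]
    simp
  have hint : ∫ ω, ∏ v, f v (ω v) ∂μ = (1 + 3 * p) ^ S.card := by
    rw [integral_fintype_prod_eq_prod]
    have : ∀ v, ∫ b, f v b ∂bernoulliMeasure p = if v ∈ S then 1 + 3 * p else 1 := by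
      intro v
      rw [integral_bernoulliMeasure h0 h1]
      by_cases hv : v ∈ S
      · simp only [f, hv, if_true, Bool.false_eq_true, if_false]; ring
      · simp [f, hv]
    simp only [this]
    rw [Finset.prod_ite_mem, Finset.univ_inter, Finset.prod_const]
  have hexp : (1 + 3 * p) ^ S.card ≤ Real.exp (3 * M) := by
    calc (1 + 3 * p) ^ S.card ≤ Real.exp (3 * p) ^ S.card := by
          gcongr
          linarith [Real.add_one_le_exp (3 * p)]
      _ = Real.exp (S.card * (3 * p)) := (Real.exp_nat_mul _ _).symm
      _ ≤ _ := Real.exp_le_exp.2 (by linarith)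
  have hM0 : 0 ≤ M := le_trans (by positivity) hM
  have hexp' : Real.exp (3 * M) ≤ (2 : ℝ) ^ (6 * M) := by
    rw [Real.rpow_def_of_pos two_pos, Real.exp_le_exp]
    nlinarith [Real.log_two_gt_d9]
  have hmarkov := mul_meas_ge_le_integral_of_nonneg (μ := μ)
    (f := fun ω => ∏ v, f v (ω v))
    (Filter.Eventually.of_forall fun ω => by simp only [hf]; positivity)
    Integrable.of_finite ((4 : ℝ) ^ (6 * M))
  rw [hint] at hmarkov
  have hsub : μ.real {ω | 6 * M < ((S.filter fun v => ω v = true).card : ℝ)} ≤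
      μ.real {ω | (4 : ℝ) ^ (6 * M) ≤ ∏ v, f v (ω v)} := by
    refine measureReal_mono fun ω hω => ?_
    simp only [Set.mem_ofPred_eq, hf] at hω ⊢
    rw [← Real.rpow_natCast]
    exact Real.rpow_le_rpow_of_exponent_le (by norm_num) hω.le
  have h4 : (4 : ℝ) ^ (6 * M) = 2 ^ (6 * M) * 2 ^ (6 * M) := by
    rw [← Real.mul_rpow] <;> norm_num
  have h2 : (0 : ℝ) < 2 ^ (6 * M) := by positivity
  rw [Real.rpow_neg zero_le_two, ← one_div, le_div_iff₀ h2]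
  refine (mul_le_mul_of_nonneg_right hsub h2.le).trans ?_
  rw [h4] at hmarkov ⊢
  refine le_of_mul_le_mul_right ?_ h2
  linarith

/-- The number of sampled edges is at most the sum over the sampled vertices of their numbers of
sampled neighbors. -/
lemma sampledEdgeCount_le_sum {V : Type*} [Fintype V] (G : SimpleGraph V) [DecidableRel G.Adj]
    (ω : V → Bool) :
    sampledEdgeCount G ω ≤ ∑ u ∈ Finset.univ.filter (fun u => ω u = true),
      ((G.neighborFinset u).filter fun v => ω v = true).card := by
  classical
  rw [← Finset.card_sigma]
  set T := (Finset.univ.filter (fun u => ω u = true)).sigma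
    fun u => (G.neighborFinset u).filter fun v => ω v = true
  refine le_trans ?_ (Finset.card_image_le (s := T) (f := fun x => s(x.1, x.2)))
  rw [sampledEdgeCount, ← Set.ncard_coe_finset]
  refine Set.ncard_le_ncard ?_ (Finset.finite_toSet _)
  rintro e ⟨he, hω⟩
  induction e with
  | _ u v =>
    simp only [Finset.coe_image, Set.mem_image]
    exact ⟨⟨u, v⟩, by simpa [T] using ⟨hω u (by simp), he, hω v (by simp)⟩, rfl⟩

/-- Let `G` have `n` vertices and maximum degree `Δ ≥ 1`. Sampling each
vertex independently with probability `p = 1/√Δ`, with probability at least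
`1 − 2^{−6n/√Δ} − n·2^{−6√Δ}` the induced subgraph on the sampled vertices has at most
`36n` edges. -/
theorem sampled_subgraph_sparse {V : Type*} [Fintype V]
    (G : SimpleGraph V) [DecidableRel G.Adj] (n Δ : ℕ)
    (hn : Fintype.card V = n) (hΔ : G.maxDegree = Δ) (hΔ1 : 1 ≤ Δ) :
    (Measure.pi fun _ : V => bernoulliMeasure (1 / Real.sqrt (Δ : ℝ)))
      {ω : V → Bool | sampledEdgeCount G ω ≤ 36 * n} ≥
      ENNReal.ofReal (1 - (2 : ℝ) ^ (-(6 * (n : ℝ)) / Real.sqrt (Δ : ℝ)) -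
        (n : ℝ) * (2 : ℝ) ^ (-(6 * Real.sqrt (Δ : ℝ)))) := by
  have hΔR : (1 : ℝ) ≤ Δ := by exact_mod_cast hΔ1
  set s := Real.sqrt (Δ : ℝ)
  have hs1 : 1 ≤ s := Real.one_le_sqrt.2 hΔR
  have hs0 : 0 < s := by linarith
  have hss : s * s = Δ := Real.mul_self_sqrt (by linarith)
  have hp0 : 0 ≤ 1 / s := by positivity
  have hp1 : 1 / s ≤ 1 := (div_le_one hs0).2 hs1
  have := isProbabilityMeasure_bernoulliMeasure hp0 hp1
  set μ := Measure.pi fun _ : V => bernoulliMeasure (1 / s)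
  let A : Set (V → Bool) := {ω | sampledEdgeCount G ω ≤ 36 * n}
  let B : Set (V → Bool) :=
    {ω | 6 * (n / s) < ((Finset.univ.filter fun v => ω v = true).card : ℝ)}
  let C : V → Set (V → Bool) := fun u =>
    {ω | 6 * s < (((G.neighborFinset u).filter fun v => ω v = true).card : ℝ)}
  have hB : μ.real B ≤ (2 : ℝ) ^ (-(6 * (n / s))) :=
    measureReal_six_mul_lt_card_filter_le hp0 hp1 Finset.univ
      (by rw [Finset.card_univ, hn, mul_one_div])
  have hC : ∀ u, μ.real (C u) ≤ (2 : ℝ) ^ (-(6 * s)) := fun u =>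
    measureReal_six_mul_lt_card_filter_le hp0 hp1 (G.neighborFinset u) (by
      rw [G.card_neighborFinset_eq_degree, mul_one_div, div_le_iff₀ hs0, hss, ← hΔ]
      exact_mod_cast G.degree_le_maxDegree u)
  have hsub : Aᶜ ⊆ B ∪ ⋃ u, C u := by
    intro ω hω
    by_contra hBC
    simp only [B, C, Set.mem_union, Set.mem_iUnion, Set.mem_ofPred_eq, not_or, not_exists,
      not_lt] at hBC
    obtain ⟨hb, hc⟩ := hBC
    refine hω ?_
    have hle : (sampledEdgeCount G ω : ℝ) ≤ 36 * n := by
      calc (sampledEdgeCount G ω : ℝ)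
          ≤ ∑ u ∈ Finset.univ.filter (fun u => ω u = true),
              (((G.neighborFinset u).filter fun v => ω v = true).card : ℝ) := by
            exact_mod_cast sampledEdgeCount_le_sum G ω
        _ ≤ (Finset.univ.filter fun u => ω u = true).card * (6 * s) := by
            rw [← nsmul_eq_mul]
            exact Finset.sum_le_card_nsmul _ _ _ fun u _ => hc u
        _ ≤ 6 * (n / s) * (6 * s) := by gcongr
        _ = 36 * n := by field_simp; ring
    exact_mod_cast hle
  have hAc : μ.real Aᶜ ≤ (2 : ℝ) ^ (-(6 * (n / s))) + n * (2 : ℝ) ^ (-(6 * s)) := by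
    calc μ.real Aᶜ ≤ μ.real (B ∪ ⋃ u, C u) := measureReal_mono hsub
      _ ≤ μ.real B + ∑ u, μ.real (C u) :=
          (measureReal_union_le _ _).trans (by gcongr; exact measureReal_iUnion_fintype_le _)
      _ ≤ (2 : ℝ) ^ (-(6 * (n / s))) + ∑ _u : V, (2 : ℝ) ^ (-(6 * s)) := by
          gcongr with u
          exact hC u
      _ = _ := by simp [hn]
  have hcompl : μ.real Aᶜ = 1 - μ.real A :=
    probReal_compl_eq_one_sub (Set.toFinite A).measurableSet
  have hexponent : -(6 * (n : ℝ)) / s = -(6 * (n / s)) := by ring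
  rw [ge_iff_le, ← ofReal_measureReal, hexponent]
  exact ENNReal.ofReal_le_ofReal (by linarith)
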